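/- Let u be a function on the unit disk D such that u(z) = m log|z| + ω(z) where m is a nonnegative integer and ω ∈ C⁰ ∩ W^{1,2}(D), and suppose the distributional Laplacian satisfies -Δu = -2mπ δ₀ + F in D where F ∈ L¹(D). Then the limit as t → 0 of ∫_{∂D_t} ∂u/∂r ds exists and equals 2πm. -/

import Mathlib

open MeasureTheory Real Filter

noncomputable section

/-- Euclidean disk of radius `r` centered at the origin in `ℝ²`. -/
def disk (r : ℝ) : Set (ℝ × ℝ) := {p | p.1 ^ 2 + p.2 ^ 2 < r ^ 2}

/-- Laplacian of a function on `ℝ²`. -/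
def lap (φ : ℝ × ℝ → ℝ) (p : ℝ × ℝ) : ℝ :=
  fderiv ℝ (fun q => fderiv ℝ φ q (1, 0)) p (1, 0) +
  fderiv ℝ (fun q => fderiv ℝ φ q (0, 1)) p (0, 1)

/-- Flux of `∇u` through the circle of radius `t`: `∫_{∂D_t} ∂u/∂r ds`. -/
def flux (u : ℝ × ℝ → ℝ) (t : ℝ) : ℝ :=
  ∫ θ in (0:ℝ)..(2 * π),
    fderiv ℝ u (t * Real.cos θ, t * Real.sin θ) (Real.cos θ, Real.sin θ) * t

/-- The squared Euclidean norm on `ℝ × ℝ`. -/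
def sqn (z : ℝ × ℝ) : ℝ := z.1 ^ 2 + z.2 ^ 2

/-- The regularized logarithmic potential `log √(|z|² + ε)`. -/
def regLog (ε : ℝ) (z : ℝ × ℝ) : ℝ := 1 / 2 * Real.log (sqn z + ε)

/-- The point of the circle of radius `r` with angle `θ`. -/
def circ (r θ : ℝ) : ℝ × ℝ := (r * Real.cos θ, r * Real.sin θ)

lemma sqn_nonneg (z : ℝ × ℝ) : 0 ≤ sqn z := by unfold sqn; positivity

lemma continuous_sqn : Continuous sqn := by unfold sqn; fun_prop

lemma sqn_circ (r θ : ℝ) : sqn (circ r θ) = r ^ 2 := by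
  simp only [sqn, circ]
  linear_combination r ^ 2 * Real.sin_sq_add_cos_sq θ

lemma sqn_circ_sub (r θ : ℝ) (y : ℝ × ℝ) :
    sqn (circ r θ - y) = r ^ 2 + sqn y - 2 * r * (y.1 * Real.cos θ + y.2 * Real.sin θ) := by
  simp only [sqn, circ, Prod.fst_sub, Prod.snd_sub]
  linear_combination r ^ 2 * Real.sin_sq_add_cos_sq θ

lemma continuous_regLog {ε : ℝ} (hε : 0 < ε) : Continuous (regLog ε) := by
  unfold regLog
  refine continuous_const.mul (Continuous.log (continuous_sqn.add continuous_const) fun z => ?_)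
  have := sqn_nonneg z
  positivity

lemma continuous_circ_right (r : ℝ) : Continuous (circ r) := by unfold circ; fun_prop

/-- The exponential of twice the mean of `regLog ε (· - y)` over the circle of radius `r`, where
`b = |y|²`. -/
def meanRad (ε b r : ℝ) : ℝ :=
  ((r ^ 2 + b + ε) + √((r ^ 2 + b + ε) ^ 2 - 4 * r ^ 2 * b)) / 2

lemma meanRad_pos {ε b r : ℝ} (hε : 0 < ε) (hb : 0 ≤ b) : 0 < meanRad ε b r := by
  unfold meanRad; positivity

lemma discr_eq (ε b r : ℝ) :
    (r ^ 2 + b + ε) ^ 2 - 4 * r ^ 2 * b = (r ^ 2 - b + ε) ^ 2 + 4 * b * ε := by ring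

lemma meanRad_mono {ε b r R : ℝ} (hε : 0 < ε) (hb : 0 ≤ b) (hr : 0 ≤ r) (hrR : r ≤ R) :
    meanRad ε b r ≤ meanRad ε b R := by
  have key : ∀ c z w : ℝ, 0 ≤ c → z ≤ w → z + √(z ^ 2 + c) ≤ w + √(w ^ 2 + c) := by
    intro c z w hc hzw
    have hz : |z| ≤ √(z ^ 2 + c) := Real.abs_le_sqrt (by linarith)
    have hw : |w| ≤ √(w ^ 2 + c) := Real.abs_le_sqrt (by linarith)
    have hz2 := Real.sq_sqrt (show 0 ≤ z ^ 2 + c by positivity)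
    have hw2 := Real.sq_sqrt (show 0 ≤ w ^ 2 + c by positivity)
    have h1 := neg_abs_le z
    have h2 := neg_abs_le w
    by_contra! hcon
    nlinarith [mul_nonneg (sub_nonneg.2 hzw) (show 0 ≤ z + √(z ^ 2 + c) by linarith),
      mul_nonneg (sub_nonneg.2 hzw) (show 0 ≤ w + √(w ^ 2 + c) by linarith),
      Real.sqrt_nonneg (z ^ 2 + c), Real.sqrt_nonneg (w ^ 2 + c)]
  have h := key (4 * b * ε) (r ^ 2 - b + ε) (R ^ 2 - b + ε) (by positivity) (by gcongr)
  unfold meanRad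
  rw [discr_eq, discr_eq]
  linarith

lemma meanRad_scale {ε b r l : ℝ} (hε : 0 < ε) (hb : 0 ≤ b) (hl : 1 ≤ l) :
    meanRad ε b (l * r) ≤ l ^ 2 * meanRad ε b r := by
  have hD : 0 ≤ (r ^ 2 + b + ε) ^ 2 - 4 * r ^ 2 * b := by rw [discr_eq]; positivity
  set D := (r ^ 2 + b + ε) ^ 2 - 4 * r ^ 2 * b with hDdef
  have hs := Real.sq_sqrt hD
  have hs0 := Real.sqrt_nonneg D
  have hc : 0 < b + ε := by positivity
  have h1 : 2 * r ^ 2 * b - r ^ 2 * (b + ε) - (b + ε) ^ 2 ≤ (b + ε) * √D := by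
    refine (le_abs_self _).trans (abs_le_of_sq_le_sq ?_ (by positivity))
    rw [mul_pow, hs]
    nlinarith [show 0 ≤ r ^ 4 * b * ε by positivity]
  have hl2 : 0 ≤ l ^ 2 - 1 := by nlinarith
  have h2 : √(((l * r) ^ 2 + b + ε) ^ 2 - 4 * (l * r) ^ 2 * b)
      ≤ l ^ 2 * √D + (l ^ 2 - 1) * (b + ε) := by
    apply Real.sqrt_le_iff.2 ⟨by positivity, ?_⟩
    have : (l ^ 2 * √D + (l ^ 2 - 1) * (b + ε)) ^ 2
      - (((l * r) ^ 2 + b + ε) ^ 2 - 4 * (l * r) ^ 2 * b) =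
      2 * l ^ 2 * (l ^ 2 - 1) *
        ((b + ε) * √D - (2 * r ^ 2 * b - r ^ 2 * (b + ε) - (b + ε) ^ 2)) := by
      linear_combination l ^ 4 * (hs.trans hDdef)
    have h3 : 0 ≤ 2 * l ^ 2 * (l ^ 2 - 1) *
        ((b + ε) * √D - (2 * r ^ 2 * b - r ^ 2 * (b + ε) - (b + ε) ^ 2)) :=
      mul_nonneg (by positivity) (by linarith)
    linarith
  unfold meanRad
  rw [← hDdef]
  nlinarith

lemma integral_regLog_circ {ε r : ℝ} (hε : 0 < ε) (y : ℝ × ℝ) :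
    ∫ θ in (0:ℝ)..2 * π, regLog ε (circ r θ - y) = π * Real.log (meanRad ε (sqn y) r) := by
  set P := meanRad ε (sqn y) r with hP
  have hy := sqn_nonneg y
  have hPpos : 0 < P := meanRad_pos hε hy
  have hD : 0 ≤ (r ^ 2 + sqn y + ε) ^ 2 - 4 * r ^ 2 * sqn y := by rw [discr_eq]; positivity
  have hPeq : P ^ 2 + r ^ 2 * sqn y = (r ^ 2 + sqn y + ε) * P := by
    have := Real.sq_sqrt hD
    rw [hP, meanRad]
    linear_combination this / 4
  have hPge : r ^ 2 * sqn y ≤ P ^ 2 := by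
    have h1 : (r ^ 2 + sqn y + ε) / 2 ≤ P := by
      rw [hP, meanRad]
      linarith [Real.sqrt_nonneg ((r ^ 2 + sqn y + ε) ^ 2 - 4 * r ^ 2 * sqn y)]
    have h2 : ((r ^ 2 + sqn y + ε) / 2) ^ 2 ≤ P ^ 2 := by gcongr
    nlinarith
  set a : ℂ := ⟨r / P * y.1, r / P * y.2⟩ with ha
  have haP : P ^ 2 * ‖a‖ ^ 2 = r ^ 2 * sqn y := by
    rw [← Complex.normSq_eq_norm_sq, Complex.normSq_apply, ha, sqn]
    field_simp
  have hanorm : ‖a‖ ≤ 1 := by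
    by_contra! h
    have : 1 < ‖a‖ ^ 2 := one_lt_pow₀ h two_ne_zero
    nlinarith [mul_pos hPpos hPpos]
  have hint : ∫ θ in (0:ℝ)..2 * π, Real.log ‖circleMap 0 1 θ - a‖ = 0 := by
    have h := circleAverage_log_norm_sub_const_eq_posLog (a := a)
    rw [(Real.posLog_eq_zero_iff _).2 (by simpa using hanorm), Real.circleAverage_def] at h
    simpa [Real.pi_ne_zero] using h
  have hpt : ∀ θ : ℝ, sqn (circ r θ - y) + ε = P * ‖circleMap 0 1 θ - a‖ ^ 2 := by
    intro θ
    rw [← Complex.normSq_eq_norm_sq, Complex.normSq_apply, sqn_circ_sub]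
    simp only [circleMap, Complex.sub_re, Complex.sub_im, zero_add, Complex.ofReal_one, one_mul,
      Complex.exp_ofReal_mul_I_re, Complex.exp_ofReal_mul_I_im, ha]
    have h4 : P * ((Real.cos θ - r / P * y.1) * (Real.cos θ - r / P * y.1)
        + (Real.sin θ - r / P * y.2) * (Real.sin θ - r / P * y.2)) =
        P * (Real.sin θ ^ 2 + Real.cos θ ^ 2) + r ^ 2 * (y.1 ^ 2 + y.2 ^ 2) / P
          - 2 * r * (y.1 * Real.cos θ + y.2 * Real.sin θ) := by
      field_simp
      ring
    rw [h4, Real.sin_sq_add_cos_sq, ← sqn]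
    have h5 : r ^ 2 + sqn y + ε = P * 1 + r ^ 2 * sqn y / P := by
      field_simp
      linarith
    linarith
  have hlog : ∀ θ : ℝ, Real.log ‖circleMap 0 1 θ - a‖
      = regLog ε (circ r θ - y) - 1 / 2 * Real.log P := by
    intro θ
    have hpos : 0 < sqn (circ r θ - y) + ε := by
      have := sqn_nonneg (circ r θ - y)
      positivity
    rw [hpt] at hpos
    have hne : ‖circleMap 0 1 θ - a‖ ^ 2 ≠ 0 := by
      intro h
      simp [h] at hpos
    rw [regLog, hpt, Real.log_mul hPpos.ne' hne, Real.log_pow]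
    push_cast
    ring
  simp_rw [hlog] at hint
  rw [intervalIntegral.integral_sub] at hint
  · simp only [intervalIntegral.integral_const, smul_eq_mul] at hint
    linarith
  · exact ((continuous_regLog hε).comp
      ((continuous_circ_right r).sub continuous_const)).intervalIntegrable _ _
  · exact intervalIntegrable_const

/-- The increment of `regLog ε (· - y)` between the circles of radii `t e^{-h}` and `t e^h` has
`L¹` norm at most `4 π h` in the angle, uniformly in `y` and `ε`. -/
lemma integral_abs_regLog_sub_le {ε t h : ℝ} (hε : 0 < ε) (ht : 0 < t) (hh : 0 < h)
    (y : ℝ × ℝ) :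
    ∫ θ in (0:ℝ)..2 * π, |regLog ε (circ (t * exp h) θ - y) - regLog ε (circ (t * exp (-h)) θ - y)|
      ≤ 4 * π * h := by
  set q : ℝ → ℝ := fun θ =>
    regLog ε (circ (t * exp h) θ - y) - regLog ε (circ (t * exp (-h)) θ - y) with hq
  have hqc : Continuous q :=
    ((continuous_regLog hε).comp ((continuous_circ_right _).sub continuous_const)).sub
      ((continuous_regLog hε).comp ((continuous_circ_right _).sub continuous_const))
  have hy := sqn_nonneg y
  have hexp : exp h * exp (-h) = 1 := by rw [← Real.exp_add]; simp
  have hle : exp (-h) ≤ exp h := Real.exp_le_exp.2 (by linarith)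
  have hsgn : (∀ θ, 0 ≤ q θ - h) ∨ (∀ θ, q θ - h ≤ 0) := by
    have hpt : ∀ θ, q θ - h = 1 / 2 * (Real.log (exp (-h) * (sqn (circ (t * exp h) θ - y) + ε))
        - Real.log (exp h * (sqn (circ (t * exp (-h)) θ - y) + ε))) := by
      intro θ
      have h1 : 0 < sqn (circ (t * exp h) θ - y) + ε := by
        have := sqn_nonneg (circ (t * exp h) θ - y); positivity
      have h2 : 0 < sqn (circ (t * exp (-h)) θ - y) + ε := by
        have := sqn_nonneg (circ (t * exp (-h)) θ - y); positivity
      rw [Real.log_mul (Real.exp_ne_zero _) h1.ne', Real.log_mul (Real.exp_ne_zero _) h2.ne']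
      simp only [hq, regLog, Real.log_exp]
      ring
    have hdiff : ∀ θ, exp (-h) * (sqn (circ (t * exp h) θ - y) + ε)
        - exp h * (sqn (circ (t * exp (-h)) θ - y) + ε)
        = (t ^ 2 - sqn y - ε) * (exp h - exp (-h)) := by
      intro θ
      rw [sqn_circ_sub, sqn_circ_sub]
      linear_combination (t ^ 2 * exp h - t ^ 2 * exp (-h)) * hexp
    rcases le_total 0 (t ^ 2 - sqn y - ε) with hs | hs
    · left
      intro θ
      rw [hpt]
      have := mul_nonneg hs (sub_nonneg.2 hle)
      have h2 : 0 < exp h * (sqn (circ (t * exp (-h)) θ - y) + ε) := by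
        have := sqn_nonneg (circ (t * exp (-h)) θ - y); positivity
      have := Real.log_le_log h2 (show _ ≤ exp (-h) * (sqn (circ (t * exp h) θ - y) + ε) by
        linarith [hdiff θ])
      linarith
    · right
      intro θ
      rw [hpt]
      have := mul_nonneg_of_nonpos_of_nonpos hs (sub_nonpos.2 hle)
      have h2 : 0 < exp (-h) * (sqn (circ (t * exp h) θ - y) + ε) := by
        have := sqn_nonneg (circ (t * exp h) θ - y); positivity
      have := Real.log_le_log h2 (show _ ≤ exp h * (sqn (circ (t * exp (-h)) θ - y) + ε) by
        linarith [hdiff θ])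
      linarith
  have hqi : IntervalIntegrable q volume 0 (2 * π) := hqc.intervalIntegrable _ _
  have hval : ∫ θ in (0:ℝ)..2 * π, q θ = π * (Real.log (meanRad ε (sqn y) (t * exp h))
      - Real.log (meanRad ε (sqn y) (t * exp (-h)))) := by
    rw [hq, intervalIntegral.integral_sub, integral_regLog_circ hε, integral_regLog_circ hε]
    · ring
    · exact ((continuous_regLog hε).comp
        ((continuous_circ_right _).sub continuous_const)).intervalIntegrable _ _
    · exact ((continuous_regLog hε).comp
        ((continuous_circ_right _).sub continuous_const)).intervalIntegrable _ _
  have hlow : 0 ≤ Real.log (meanRad ε (sqn y) (t * exp h))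
      - Real.log (meanRad ε (sqn y) (t * exp (-h))) :=
    sub_nonneg.2 (Real.log_le_log (meanRad_pos hε hy)
      (meanRad_mono hε hy (by positivity) (by gcongr)))
  have hupp : Real.log (meanRad ε (sqn y) (t * exp h))
      - Real.log (meanRad ε (sqn y) (t * exp (-h))) ≤ 4 * h := by
    have h1 := meanRad_scale (r := t * exp (-h)) (l := exp (2 * h)) hε hy
      (Real.one_le_exp (by linarith))
    have h2 : exp (2 * h) * (t * exp (-h)) = t * exp h := by
      rw [mul_left_comm, ← Real.exp_add]
      ring_nf
    rw [h2] at h1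
    have h3 := Real.log_le_log (meanRad_pos hε hy) h1
    rw [Real.log_mul (by positivity) (meanRad_pos hε hy).ne', Real.log_pow, Real.log_exp] at h3
    push_cast at h3
    linarith
  have hsub : ∫ θ in (0:ℝ)..2 * π, (q θ - h) = (∫ θ in (0:ℝ)..2 * π, q θ) - 2 * π * h := by
    rw [intervalIntegral.integral_sub hqi intervalIntegrable_const]
    simp
  have habs : ∫ θ in (0:ℝ)..2 * π, |q θ - h| ≤ 2 * π * h := by
    have hpi := Real.pi_pos
    rcases hsgn with hs | hs
    · simp_rw [fun θ => abs_of_nonneg (hs θ)]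
      rw [hsub, hval]
      nlinarith
    · simp_rw [fun θ => abs_of_nonpos (hs θ)]
      rw [intervalIntegral.integral_neg, hsub, hval]
      nlinarith
  calc ∫ θ in (0:ℝ)..2 * π, |q θ| ≤ ∫ θ in (0:ℝ)..2 * π, (|q θ - h| + h) := by
        apply intervalIntegral.integral_mono_on (by positivity)
          (hqc.abs.intervalIntegrable _ _)
          (((hqc.sub continuous_const).abs.add continuous_const).intervalIntegrable _ _)
        intro θ _
        have := abs_add_le (q θ - h) h
        rw [sub_add_cancel, abs_of_pos hh] at this
        exact this
    _ = (∫ θ in (0:ℝ)..2 * π, |q θ - h|) + 2 * π * h := by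
        have hc : Continuous fun θ => |q θ - h| := (hqc.sub continuous_const).abs
        rw [intervalIntegral.integral_add (hc.intervalIntegrable _ _) intervalIntegrable_const]
        simp
    _ ≤ 4 * π * h := by linarith

lemma contDiff_regLog {ε : ℝ} (hε : 0 < ε) {n : WithTop ℕ∞} : ContDiff ℝ n (regLog ε) := by
  unfold regLog
  refine contDiff_const.mul (ContDiff.log (by unfold sqn; fun_prop) fun z => ?_)
  have := sqn_nonneg z
  positivity

lemma contDiff_regLog_sub {ε : ℝ} (hε : 0 < ε) (x : ℝ × ℝ) {n : WithTop ℕ∞} :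
    ContDiff ℝ n fun y => regLog ε (x - y) :=
  (contDiff_regLog hε).comp (contDiff_const.sub contDiff_id)

lemma contDiff_fderiv_apply {f : ℝ × ℝ → ℝ} (hf : ContDiff ℝ (⊤ : ℕ∞) f) (v : ℝ × ℝ) :
    ContDiff ℝ (⊤ : ℕ∞) fun y => fderiv ℝ f y v :=
  (hf.fderiv_right (m := (⊤ : ℕ∞)) (by norm_cast)).clm_apply contDiff_const

lemma continuous_lap {f : ℝ × ℝ → ℝ} (hf : ContDiff ℝ (⊤ : ℕ∞) f) : Continuous (lap f) :=
  (contDiff_fderiv_apply (contDiff_fderiv_apply hf _) _).continuous.add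
    (contDiff_fderiv_apply (contDiff_fderiv_apply hf _) _).continuous

lemma lap_mul {f g : ℝ × ℝ → ℝ} (hf : ContDiff ℝ (⊤ : ℕ∞) f) (hg : ContDiff ℝ (⊤ : ℕ∞) g)
    (p : ℝ × ℝ) :
    lap (fun y => f y * g y) p = f p * lap g p
      + (2 * (fderiv ℝ f p (1, 0) * fderiv ℝ g p (1, 0) + fderiv ℝ f p (0, 1) * fderiv ℝ g p (0, 1))
        + g p * lap f p) := by
  have hfd : Differentiable ℝ f := hf.differentiable (by simp)
  have hgd : Differentiable ℝ g := hg.differentiable (by simp)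
  have hfd' (v) : Differentiable ℝ fun y => fderiv ℝ f y v :=
    (contDiff_fderiv_apply hf v).differentiable (by simp)
  have hgd' (v) : Differentiable ℝ fun y => fderiv ℝ g y v :=
    (contDiff_fderiv_apply hg v).differentiable (by simp)
  have h1 (v) : (fun q => fderiv ℝ (fun y => f y * g y) q v)
      = fun q => f q * fderiv ℝ g q v + g q * fderiv ℝ f q v := by
    funext q
    rw [fderiv_fun_mul (hfd q) (hgd q)]
    simp
  have h2 (v) : fderiv ℝ (fun q => fderiv ℝ (fun y => f y * g y) q v) p v
      = f p * fderiv ℝ (fun q => fderiv ℝ g q v) p v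
        + (2 * (fderiv ℝ f p v * fderiv ℝ g p v) + g p * fderiv ℝ (fun q => fderiv ℝ f q v) p v) := by
    rw [h1, fderiv_fun_add ((hfd p).fun_mul (hgd' v p)) ((hgd p).fun_mul (hfd' v p)),
      fderiv_fun_mul (hfd p) (hgd' v p), fderiv_fun_mul (hgd p) (hfd' v p)]
    simp
    ring
  unfold lap
  rw [h2, h2]
  ring

lemma hasFDerivAt_sqn_sub (x y : ℝ × ℝ) :
    HasFDerivAt (fun y => sqn (x - y)) (-(2 * (x - y).1) • ContinuousLinearMap.fst ℝ ℝ ℝ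
      - (2 * (x - y).2) • ContinuousLinearMap.snd ℝ ℝ ℝ) y := by
  have h1 : HasFDerivAt (fun y : ℝ × ℝ => x.1 - y.1) (-ContinuousLinearMap.fst ℝ ℝ ℝ) y :=
    hasFDerivAt_fst.const_sub x.1
  have h2 : HasFDerivAt (fun y : ℝ × ℝ => x.2 - y.2) (-ContinuousLinearMap.snd ℝ ℝ ℝ) y :=
    hasFDerivAt_snd.const_sub x.2
  refine ((h1.pow 2).add (h2.pow 2)).congr_fderiv ?_
  ext <;> simp

lemma fderiv_regLog_sub {ε : ℝ} (hε : 0 < ε) (x y v : ℝ × ℝ) :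
    fderiv ℝ (fun y => regLog ε (x - y)) y v
      = -((x - y).1 * v.1 + (x - y).2 * v.2) / (sqn (x - y) + ε) := by
  have hpos : 0 < sqn (x - y) + ε := by have := sqn_nonneg (x - y); positivity
  have h := (((hasFDerivAt_sqn_sub x y).add_const ε).log hpos.ne').const_mul (1 / 2)
  have h' : HasFDerivAt (fun y => regLog ε (x - y)) _ y := h
  rw [h'.fderiv]
  simp
  field_simp
  ring

lemma lap_regLog_sub {ε : ℝ} (hε : 0 < ε) (x y : ℝ × ℝ) :
    lap (fun y => regLog ε (x - y)) y = 2 * ε / (sqn (x - y) + ε) ^ 2 := by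
  have hpos : 0 < sqn (x - y) + ε := by have := sqn_nonneg (x - y); positivity
  have h1 : HasFDerivAt (fun y : ℝ × ℝ => -(x - y).1) (ContinuousLinearMap.fst ℝ ℝ ℝ) y := by
    simpa using hasFDerivAt_fst
  have h2 : HasFDerivAt (fun y : ℝ × ℝ => -(x - y).2) (ContinuousLinearMap.snd ℝ ℝ ℝ) y := by
    simpa using hasFDerivAt_snd
  have hs := ((hasFDerivAt_sqn_sub x y).add_const ε)
  have hi := (hasDerivAt_inv hpos.ne').comp_hasFDerivAt y hs
  have h3 : HasFDerivAt (fun y => -(x - y).1 * (sqn (x - y) + ε)⁻¹) _ y := h1.mul hi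
  have h4 : HasFDerivAt (fun y => -(x - y).2 * (sqn (x - y) + ε)⁻¹) _ y := h2.mul hi
  unfold lap
  simp_rw [fderiv_regLog_sub hε]
  simp only [mul_one, mul_zero, add_zero, zero_add, div_eq_mul_inv]
  rw [h3.fderiv, h4.fderiv]
  simp
  unfold sqn at hpos ⊢
  simp at hpos ⊢
  field_simp
  ring

lemma integral_inv_one_add_sqn_sq : ∫ z : ℝ × ℝ, ((1 + sqn z) ^ 2)⁻¹ = π := by
  rw [← integral_comp_polarCoord_symm]
  have h1 : ∀ p : ℝ × ℝ, p.1 • ((1 + sqn (polarCoord.symm p)) ^ 2)⁻¹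
      = p.1 * ((1 + p.1 ^ 2) ^ 2)⁻¹ * 1 := by
    intro p
    rw [polarCoord_symm_apply, ← circ, sqn_circ, smul_eq_mul, mul_one]
  simp_rw [h1]
  rw [polarCoord_target, Measure.volume_eq_prod,
    setIntegral_prod_mul (fun r : ℝ => r * ((1 + r ^ 2) ^ 2)⁻¹) (fun _ : ℝ => (1 : ℝ))]
  have h2 : ∫ r in Set.Ioi (0:ℝ), r * ((1 + r ^ 2) ^ 2)⁻¹ = 0 - (-(1 / 2) * (1 + (0:ℝ) ^ 2)⁻¹) := by
    apply integral_Ioi_of_hasDerivAt_of_nonneg' (g := fun r : ℝ => -(1 / 2) * (1 + r ^ 2)⁻¹)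
    · intro r _
      have hne : (1 + r ^ 2) ≠ 0 := by positivity
      refine (((((hasDerivAt_id r).pow 2).const_add 1).inv hne).const_mul _).congr_deriv ?_
      simp
      field_simp
    · intro r hr
      have : 0 < r := hr
      positivity
    · have : Tendsto (fun r : ℝ => 1 + r ^ 2) atTop atTop :=
        tendsto_atTop_add_const_left _ _ (tendsto_pow_atTop two_ne_zero)
      have h := this.inv_tendsto_atTop.const_mul (-(1 / 2))
      rw [mul_zero] at h
      exact h
  rw [h2]
  have hpi := Real.pi_pos
  simp [hpi.le]
  ring

lemma norm_sq_le_sqn (z : ℝ × ℝ) : ‖z‖ ^ 2 ≤ sqn z := by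
  rw [Prod.norm_def, sqn]
  rcases max_choice ‖z.1‖ ‖z.2‖ with h | h <;> rw [h, Real.norm_eq_abs, sq_abs] <;> nlinarith

/-- The Laplacians of `regLog ε` form an approximate identity of mass `2π`. -/
lemma tendsto_integral_peak {g : ℝ × ℝ → ℝ} {x : ℝ × ℝ} (hg : Integrable g)
    (hx : ContinuousAt g x) :
    Tendsto (fun ε : ℝ => ∫ y, 2 * ε / (sqn (x - y) + ε) ^ 2 * g y) (nhdsWithin 0 (Set.Ioi 0))
      (nhds (2 * π * g x)) := by
  have hpi := Real.pi_pos
  have key := tendsto_integral_comp_smul_smul_of_integrable' (μ := (volume : Measure (ℝ × ℝ)))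
    (φ := fun z => π⁻¹ * ((1 + sqn z) ^ 2)⁻¹) (g := g) (x₀ := x)
    (fun z => by positivity)
    (by rw [integral_const_mul, integral_inv_one_add_sqn_sq, inv_mul_cancel₀ hpi.ne'])
    (by
      have hlim : Tendsto (fun z : ℝ × ℝ => π⁻¹ * ‖z‖⁻¹) (Bornology.cobounded _) (nhds 0) := by
        simpa using (tendsto_norm_cobounded_atTop.inv_tendsto_atTop).const_mul π⁻¹
      refine squeeze_zero' (Eventually.of_forall fun z => by positivity) ?_ hlim
      filter_upwards [tendsto_norm_cobounded_atTop.eventually_ge_atTop (1:ℝ)] with z hz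
      have hn := norm_sq_le_sqn z
      have hn0 : 0 < ‖z‖ := by linarith
      simp only [Module.finrank_prod, Module.finrank_self, Nat.reduceAdd]
      rw [mul_left_comm]
      gcongr
      rw [← div_eq_mul_inv, ← one_div, div_le_div_iff₀ (by have := sqn_nonneg z; positivity) hn0]
      have h1 : ‖z‖ ^ 2 * ‖z‖ ≤ (‖z‖ ^ 2) ^ 2 := by nlinarith [pow_pos hn0 3]
      nlinarith [sqn_nonneg z])
    hg hx
  have hc : Tendsto (fun ε : ℝ => (√ε)⁻¹) (nhdsWithin 0 (Set.Ioi 0)) atTop := by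
    apply Tendsto.inv_tendsto_nhdsGT_zero
    refine tendsto_nhdsWithin_iff.2 ⟨?_, ?_⟩
    · exact (Real.continuous_sqrt.tendsto' 0 0 (by simp)).mono_left nhdsWithin_le_nhds
    · filter_upwards [self_mem_nhdsWithin] with ε hε using Real.sqrt_pos.2 hε
  refine ((key.comp hc).const_mul (2 * π)).congr' ?_
  filter_upwards [self_mem_nhdsWithin] with ε hε
  have hε' : 0 < ε := hε
  rw [Function.comp_apply, ← integral_const_mul]
  congr 1 with y
  have hs := sqn_nonneg (x - y)
  have h1 : sqn ((√ε)⁻¹ • (x - y)) = ε⁻¹ * sqn (x - y) := by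
    simp only [sqn, Prod.smul_fst, Prod.smul_snd, smul_eq_mul, mul_pow, inv_pow,
      Real.sq_sqrt hε'.le]
    ring
  rw [h1]
  simp only [Module.finrank_prod, Module.finrank_self, Nat.reduceAdd, inv_pow,
    Real.sq_sqrt hε'.le, smul_eq_mul]
  field_simp
  ring

lemma abs_log_sub_log_le {a b c : ℝ} (hc : 0 < c) (ha : c ≤ a) (hb : c ≤ b) :
    |Real.log a - Real.log b| ≤ |a - b| / c := by
  have key : ∀ a b : ℝ, c ≤ a → c ≤ b → Real.log a - Real.log b ≤ |a - b| / c := by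
    intro a b ha hb
    have ha' : 0 < a := hc.trans_le ha
    have hb' : 0 < b := hc.trans_le hb
    rw [← Real.log_div ha'.ne' hb'.ne']
    calc Real.log (a / b) ≤ a / b - 1 := Real.log_le_sub_one_of_pos (by positivity)
      _ = (a - b) / b := by field_simp
      _ ≤ |a - b| / b := by gcongr; exact le_abs_self _
      _ ≤ |a - b| / c := by gcongr
  refine abs_le.2 ⟨?_, key a b ha hb⟩
  have := key b a hb ha
  rw [abs_sub_comm] at this
  linarith

lemma abs_regLog_circ_sub_le {ε r R θ : ℝ} {y : ℝ × ℝ} (hε : 0 < ε) (hr : 0 ≤ r) (hrR : r ≤ R)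
    (hy : 0 < sqn y) (hRy : 4 * R ^ 2 ≤ sqn y) :
    |regLog ε (circ R θ - y) - regLog ε (circ r θ - y)| ≤ 6 * (R - r) / √(sqn y) := by
  have hp := Real.sq_sqrt hy.le
  have hp0 : 0 < √(sqn y) := Real.sqrt_pos.2 hy
  set p := √(sqn y) with hpdef
  have hRp : 2 * R ≤ p := by
    rw [hpdef]
    exact Real.le_sqrt_of_sq_le (by linarith)
  set s := y.1 * Real.cos θ + y.2 * Real.sin θ with hs
  have hsp : |s| ≤ p := by
    refine Real.abs_le_sqrt ?_
    rw [sqn, hs]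
    nlinarith [sq_nonneg (y.1 * Real.sin θ - y.2 * Real.cos θ), Real.sin_sq_add_cos_sq θ]
  obtain ⟨hs1, hs2⟩ := abs_le.1 hsp
  have hlow : ∀ ρ, 0 ≤ ρ → ρ ≤ R → p ^ 2 / 4 ≤ sqn (circ ρ θ - y) + ε := by
    intro ρ h0 h1
    rw [sqn_circ_sub, ← hs, ← hp]
    nlinarith [mul_nonneg h0 (sub_nonneg.2 hs2)]
  have hlog := abs_log_sub_log_le (by positivity) (hlow R (hr.trans hrR) le_rfl) (hlow r hr hrR)
  have hdiff : |(sqn (circ R θ - y) + ε) - (sqn (circ r θ - y) + ε)| ≤ (R - r) * (3 * p) := by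
    have : (sqn (circ R θ - y) + ε) - (sqn (circ r θ - y) + ε) = (R - r) * (R + r - 2 * s) := by
      rw [sqn_circ_sub, sqn_circ_sub, ← hs]
      ring
    rw [this, abs_mul, abs_of_nonneg (sub_nonneg.2 hrR)]
    gcongr
    exact abs_le.2 ⟨by linarith, by linarith⟩
  unfold regLog
  rw [← mul_sub, abs_mul, abs_of_pos (by norm_num : (0:ℝ) < 1 / 2)]
  calc _ ≤ 1 / 2 * ((R - r) * (3 * p) / (p ^ 2 / 4)) := by
        refine mul_le_mul_of_nonneg_left (hlog.trans ?_) (by norm_num)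
        gcongr
    _ = 6 * (R - r) / p := by field_simp; ring

/-- The part of the Laplacian of `χ · regLog ε (x - ·)` that involves derivatives of `χ`. -/
def cutoffRem (χ : ℝ × ℝ → ℝ) (ε : ℝ) (x y : ℝ × ℝ) : ℝ :=
  2 * (fderiv ℝ χ y (1, 0) * fderiv ℝ (fun y => regLog ε (x - y)) y (1, 0)
    + fderiv ℝ χ y (0, 1) * fderiv ℝ (fun y => regLog ε (x - y)) y (0, 1))
  + regLog ε (x - y) * lap χ y

lemma abs_sqn_sub_sqn_le {z w : ℝ × ℝ} {d : ℝ} (hz : ‖z‖ ≤ 1) (hw : ‖w‖ ≤ 1)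
    (hd : ‖z - w‖ ≤ d) : |sqn z - sqn w| ≤ 4 * d := by
  have hz1 := (norm_fst_le z).trans hz
  have hz2 := (norm_snd_le z).trans hz
  have hw1 := (norm_fst_le w).trans hw
  have hw2 := (norm_snd_le w).trans hw
  have hd1 := (norm_fst_le (z - w)).trans hd
  have hd2 := (norm_snd_le (z - w)).trans hd
  simp only [Real.norm_eq_abs, Prod.fst_sub, Prod.snd_sub] at *
  have h0 : 0 ≤ d := (abs_nonneg _).trans hd1
  have hsplit : sqn z - sqn w
      = (z.1 - w.1) * (z.1 + w.1) + (z.2 - w.2) * (z.2 + w.2) := by unfold sqn; ring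
  rw [hsplit]
  refine (abs_add_le _ _).trans ?_
  rw [abs_mul, abs_mul]
  have h1 : |z.1 + w.1| ≤ 2 := (abs_add_le _ _).trans (by linarith)
  have h2 : |z.2 + w.2| ≤ 2 := (abs_add_le _ _).trans (by linarith)
  have h3 := mul_le_mul hd1 h1 (abs_nonneg _) h0
  have h4 := mul_le_mul hd2 h2 (abs_nonneg _) h0
  linarith

lemma abs_div_sub_div_le {a b s s' c d : ℝ} (hc : 0 < c) (ha : c ≤ a) (hb : c ≤ b)
    (hs' : |s'| ≤ 1) (hd : |s - s'| ≤ d) (hab : |a - b| ≤ 4 * d) :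
    |s / a - s' / b| ≤ (1 / c + 4 / c ^ 2) * d := by
  have ha' : 0 < a := hc.trans_le ha
  have hb' : 0 < b := hc.trans_le hb
  have hd0 : 0 ≤ d := (abs_nonneg _).trans hd
  have : s / a - s' / b = (s - s') / a + s' * (b - a) / (a * b) := by field_simp; ring
  rw [this]
  refine (abs_add_le _ _).trans ?_
  rw [abs_div, abs_div, abs_mul, abs_of_pos ha', abs_of_pos (mul_pos ha' hb'), abs_sub_comm b a]
  have h1 : |s - s'| / a ≤ d / c := by gcongr
  have h2 : |s'| * |a - b| / (a * b) ≤ 1 * (4 * d) / (c * c) := by gcongr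
  calc _ ≤ d / c + 1 * (4 * d) / (c * c) := add_le_add h1 h2
    _ = _ := by field_simp

/-- Away from the singularity, `cutoffRem` is Lipschitz in the first variable, uniformly in `ε`. -/
lemma abs_cutoffRem_sub_le {χ : ℝ × ℝ → ℝ} {M c ε d : ℝ} {x x' y : ℝ × ℝ} (hc : 0 < c)
    (hε : 0 < ε) (h1 : |fderiv ℝ χ y (1, 0)| ≤ M) (h2 : |fderiv ℝ χ y (0, 1)| ≤ M)
    (h3 : |lap χ y| ≤ M) (hz : ‖x - y‖ ≤ 1) (hw : ‖x' - y‖ ≤ 1) (hzc : c ≤ sqn (x - y))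
    (hwc : c ≤ sqn (x' - y)) (hd : ‖x - x'‖ ≤ d) :
    |cutoffRem χ ε x y - cutoffRem χ ε x' y| ≤ (4 * (1 / c + 4 / c ^ 2) + 2 / c) * M * d := by
  have hM : 0 ≤ M := (abs_nonneg _).trans h1
  have hsub : (x - y) - (x' - y) = x - x' := by abel
  have hd' : ‖(x - y) - (x' - y)‖ ≤ d := by rwa [hsub]
  have hsq := abs_sqn_sub_sqn_le hz hw hd'
  have hd1 := (norm_fst_le _).trans hd'
  have hd2 := (norm_snd_le _).trans hd'
  have hw1 := (norm_fst_le _).trans hw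
  have hw2 := (norm_snd_le _).trans hw
  rw [Real.norm_eq_abs] at hd1 hd2 hw1 hw2
  have hsq' : |(sqn (x - y) + ε) - (sqn (x' - y) + ε)| ≤ 4 * d := by
    rwa [add_sub_add_right_eq_sub]
  have e1 := abs_div_sub_div_le (s := (x - y).1) (s' := (x' - y).1) hc (by linarith)
    (by linarith) hw1 hd1 hsq'
  have e2 := abs_div_sub_div_le (s := (x - y).2) (s' := (x' - y).2) hc (by linarith)
    (by linarith) hw2 hd2 hsq'
  have e3 : |regLog ε (x - y) - regLog ε (x' - y)| ≤ 2 / c * d := by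
    unfold regLog
    rw [← mul_sub, abs_mul, abs_of_pos (by norm_num : (0:ℝ) < 1 / 2)]
    have := (abs_log_sub_log_le hc (a := sqn (x - y) + ε) (b := sqn (x' - y) + ε) (by linarith)
      (by linarith)).trans (div_le_div_of_nonneg_right hsq' hc.le)
    calc _ ≤ 1 / 2 * (4 * d / c) := by gcongr
      _ = 2 / c * d := by ring
  have hexp : cutoffRem χ ε x y - cutoffRem χ ε x' y
      = -2 * (fderiv ℝ χ y (1, 0) * ((x - y).1 / (sqn (x - y) + ε)
          - (x' - y).1 / (sqn (x' - y) + ε)))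
        + (-2 * (fderiv ℝ χ y (0, 1) * ((x - y).2 / (sqn (x - y) + ε)
          - (x' - y).2 / (sqn (x' - y) + ε)))
        + lap χ y * (regLog ε (x - y) - regLog ε (x' - y))) := by
    unfold cutoffRem
    simp only [fderiv_regLog_sub hε]
    ring
  rw [hexp]
  refine (abs_add_le _ _).trans ((add_le_add_right (abs_add_le _ _) _).trans ?_)
  simp only [abs_mul, abs_neg, abs_two]
  have f1 := mul_le_mul h1 e1 (abs_nonneg _) hM
  have f2 := mul_le_mul h2 e2 (abs_nonneg _) hM
  have f3 := mul_le_mul h3 e3 (abs_nonneg _) hM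
  linarith

lemma isOpen_disk (r : ℝ) : IsOpen (disk r) :=
  isOpen_lt (by fun_prop) continuous_const

lemma lap_eq_zero_of_notMem_tsupport {χ : ℝ × ℝ → ℝ} {y : ℝ × ℝ} (hy : y ∉ tsupport χ) :
    lap χ y = 0 := by
  have h (v : ℝ × ℝ) : fderiv ℝ (fun q => fderiv ℝ χ q v) y v = 0 := by
    have : (fun q => fderiv ℝ χ q v) =ᶠ[nhds y] fun _ => 0 := by
      filter_upwards [(isClosed_tsupport χ).isOpen_compl.mem_nhds hy] with q hq
      rw [fderiv_of_notMem_tsupport ℝ hq]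
      simp
    rw [this.fderiv_eq]
    simp
  simp [lap, h]

lemma continuous_cutoffRem {χ : ℝ × ℝ → ℝ} (hχ : ContDiff ℝ (⊤ : ℕ∞) χ) {ε : ℝ} (hε : 0 < ε)
    (x : ℝ × ℝ) : Continuous (cutoffRem χ ε x) := by
  have hL : ContDiff ℝ (⊤ : ℕ∞) fun y => regLog ε (x - y) := contDiff_regLog_sub hε x
  have h1 (v) := (contDiff_fderiv_apply hχ v).continuous
  have h2 (v) := (contDiff_fderiv_apply hL v).continuous
  exact (continuous_const.mul (((h1 _).mul (h2 _)).add ((h1 _).mul (h2 _)))).add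
    (hL.continuous.mul (continuous_lap hχ))

lemma integrable_mul_of_hasCompactSupport {f g : ℝ × ℝ → ℝ} {μ : Measure (ℝ × ℝ)}
    (hf : Integrable f μ) (hg : Continuous g) (hc : HasCompactSupport g) :
    Integrable (fun y => f y * g y) μ := by
  obtain ⟨C, hC⟩ := hc.exists_bound_of_continuous hg
  exact hf.mul_bdd (c := C) hg.aestronglyMeasurable (Eventually.of_forall hC)

section Cutoff

variable {u F χ : ℝ × ℝ → ℝ} {κ ε : ℝ}

lemma hasCompactSupport_cutoffRem (hcs : HasCompactSupport χ) (ε : ℝ) (x : ℝ × ℝ) :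
    HasCompactSupport (cutoffRem χ ε x) := by
  refine HasCompactSupport.intro hcs fun y hy => ?_
  simp [cutoffRem, fderiv_of_notMem_tsupport ℝ hy, lap_eq_zero_of_notMem_tsupport hy]

lemma integral_peak_eq (hχ : ContDiff ℝ (⊤ : ℕ∞) χ) (hcs : HasCompactSupport χ)
    (hsub : tsupport χ ⊆ disk 1) (hχ0 : χ (0, 0) = 1) (hu : IntegrableOn u (tsupport χ))
    (hdist : ∀ φ : ℝ × ℝ → ℝ, ContDiff ℝ (⊤ : ℕ∞) φ → HasCompactSupport φ → tsupport φ ⊆ disk 1 →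
      -∫ p in disk 1, u p * lap φ p = -κ * φ (0, 0) + ∫ p in disk 1, F p * φ p)
    (hε : 0 < ε) (x : ℝ × ℝ) :
    ∫ y, 2 * ε / (sqn (x - y) + ε) ^ 2 * ((tsupport χ).indicator u y * χ y)
      = κ * regLog ε x - (∫ y in disk 1, F y * (χ y * regLog ε (x - y)))
        - ∫ y in tsupport χ, u y * cutoffRem χ ε x y := by
  have hL : ContDiff ℝ (⊤ : ℕ∞) fun y => regLog ε (x - y) := contDiff_regLog_sub hε x
  have hts : tsupport (fun y => χ y * regLog ε (x - y)) ⊆ tsupport χ :=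
    closure_mono (Function.support_mul_subset_left _ _)
  have h := hdist (fun y => χ y * regLog ε (x - y)) (hχ.mul hL) hcs.mul_right (hts.trans hsub)
  have hx0 : x - (0, 0) = x := sub_zero x
  rw [hχ0, hx0, one_mul] at h
  have hmeas : MeasurableSet (tsupport χ) := (isClosed_tsupport χ).measurableSet
  have hk : Continuous fun y => 2 * ε / (sqn (x - y) + ε) ^ 2 := by
    have hlap := continuous_lap hL
    exact hlap.congr fun y => lap_regLog_sub hε x y
  have hi1 : Integrable (fun y => (tsupport χ).indicator u y *
      (χ y * (2 * ε / (sqn (x - y) + ε) ^ 2))) :=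
    integrable_mul_of_hasCompactSupport ((integrable_indicator_iff hmeas).2 hu)
      (hχ.continuous.mul hk) hcs.mul_right
  have hi2 : Integrable (fun y => (tsupport χ).indicator u y * cutoffRem χ ε x y) :=
    integrable_mul_of_hasCompactSupport ((integrable_indicator_iff hmeas).2 hu)
      (continuous_cutoffRem hχ hε x) (hasCompactSupport_cutoffRem hcs ε x)
  have hsplit : ∫ p in disk 1, u p * lap (fun y => χ y * regLog ε (x - y)) p
      = (∫ y, (tsupport χ).indicator u y * (χ y * (2 * ε / (sqn (x - y) + ε) ^ 2)))
        + ∫ y, (tsupport χ).indicator u y * cutoffRem χ ε x y := by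
    rw [← integral_add hi1 hi2, ← integral_indicator (isOpen_disk 1).measurableSet]
    congr 1 with y
    by_cases hy : y ∈ tsupport χ
    · rw [Set.indicator_of_mem (hsub hy), Set.indicator_of_mem hy, lap_mul hχ hL,
        lap_regLog_sub hε, cutoffRem]
      ring
    · rw [Set.indicator_of_notMem hy]
      by_cases hd : y ∈ disk 1
      · rw [Set.indicator_of_mem hd, lap_eq_zero_of_notMem_tsupport fun h => hy (hts h)]
        simp
      · rw [Set.indicator_of_notMem hd]
        simp
  have hind : ∫ y, (tsupport χ).indicator u y * cutoffRem χ ε x y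
      = ∫ y in tsupport χ, u y * cutoffRem χ ε x y := by
    rw [← integral_indicator hmeas]
    congr 1 with y
    rw [Set.indicator_mul_left]
  have hcomm : ∫ y, 2 * ε / (sqn (x - y) + ε) ^ 2 * ((tsupport χ).indicator u y * χ y)
      = ∫ y, (tsupport χ).indicator u y * (χ y * (2 * ε / (sqn (x - y) + ε) ^ 2)) := by
    congr 1 with y
    ring
  rw [hsplit, hind] at h
  rw [hcomm]
  linarith

end Cutoff

/-- A smooth cutoff, equal to one near the origin and supported in the unit disk. -/
def cutoff : ContDiffBump (0 : ℝ × ℝ) := ⟨1 / 4, 1 / 2, by norm_num, by norm_num⟩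

lemma tsupport_cutoff : tsupport cutoff = Metric.closedBall 0 (1 / 2) := cutoff.tsupport_eq

lemma sqn_le_of_norm_le {z : ℝ × ℝ} {r : ℝ} (hz : ‖z‖ ≤ r) : sqn z ≤ 2 * r ^ 2 := by
  have h1 := (norm_fst_le z).trans hz
  have h2 := (norm_snd_le z).trans hz
  rw [Real.norm_eq_abs] at h1 h2
  have := sq_le_sq' (by linarith [neg_abs_le z.1]) ((le_abs_self _).trans h1)
  have := sq_le_sq' (by linarith [neg_abs_le z.2]) ((le_abs_self _).trans h2)
  unfold sqn
  linarith

lemma tsupport_cutoff_subset : tsupport cutoff ⊆ disk 1 := by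
  intro y hy
  rw [tsupport_cutoff, mem_closedBall_zero_iff] at hy
  have := sqn_le_of_norm_le hy
  change sqn y < 1 ^ 2
  linarith

lemma exists_abs_cutoffRem_sub_le :
    ∃ C : ℝ, 0 ≤ C ∧ ∀ ε : ℝ, 0 < ε → ∀ x x' : ℝ × ℝ, ‖x‖ ≤ 1 / 8 → ‖x'‖ ≤ 1 / 8 → ∀ d : ℝ,
      ‖x - x'‖ ≤ d → ∀ y ∈ tsupport cutoff,
      |cutoffRem cutoff ε x y - cutoffRem cutoff ε x' y| ≤ C * d := by
  have hχ : ContDiff ℝ (⊤ : ℕ∞) cutoff := cutoff.contDiff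
  have hK : IsCompact (tsupport cutoff) := cutoff.hasCompactSupport
  obtain ⟨M1, h1⟩ := hK.exists_bound_of_continuousOn
    (contDiff_fderiv_apply hχ (1, 0)).continuous.continuousOn
  obtain ⟨M2, h2⟩ := hK.exists_bound_of_continuousOn
    (contDiff_fderiv_apply hχ (0, 1)).continuous.continuousOn
  obtain ⟨M3, h3⟩ := hK.exists_bound_of_continuousOn (continuous_lap hχ).continuousOn
  set M := max |M1| (max |M2| |M3|) with hM
  have hM1 : |M1| ≤ M := le_max_left _ _
  have hM2 : |M2| ≤ M := (le_max_left _ _).trans (le_max_right _ _)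
  have hM3 : |M3| ≤ M := (le_max_right _ _).trans (le_max_right _ _)
  have hM0 : 0 ≤ M := (abs_nonneg _).trans hM1
  refine ⟨(4 * (1 / (1 / 64) + 4 / (1 / 64) ^ 2) + 2 / (1 / 64)) * M, by positivity, ?_⟩
  intro ε hε x x' hx hx' d hd y hy
  have hd0 : 0 ≤ d := (norm_nonneg _).trans hd
  rcases lt_or_ge ‖y‖ (1 / 4) with hlt | hge
  · have hev : ∀ q ∈ Metric.ball (0 : ℝ × ℝ) (1 / 4), fderiv ℝ cutoff q = 0 := by
      intro q hq
      have := cutoff.eventuallyEq_one_of_mem_ball (x := q) hq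
      rw [this.fderiv_eq]
      simp
    have hyb : y ∈ Metric.ball (0 : ℝ × ℝ) (1 / 4) := by simpa using hlt
    have hl (v : ℝ × ℝ) : fderiv ℝ (fun q => fderiv ℝ cutoff q v) y v = 0 := by
      have : (fun q => fderiv ℝ cutoff q v) =ᶠ[nhds y] fun _ => 0 := by
        filter_upwards [Metric.isOpen_ball.mem_nhds hyb] with q hq
        rw [hev q hq]
        simp
      rw [this.fderiv_eq]
      simp
    have hz (x : ℝ × ℝ) : cutoffRem cutoff ε x y = 0 := by
      simp [cutoffRem, hev y hyb, lap, hl]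
    rw [hz, hz]
    simp only [sub_self, abs_zero]
    positivity
  · rw [tsupport_cutoff, mem_closedBall_zero_iff] at hy
    have hfar (x : ℝ × ℝ) (hx : ‖x‖ ≤ 1 / 8) : 1 / 64 ≤ sqn (x - y) ∧ ‖x - y‖ ≤ 1 := by
      have h4 := norm_sub_norm_le y x
      rw [norm_sub_rev] at h4
      have h5 := norm_sub_le x y
      refine ⟨?_, by linarith⟩
      have := norm_sq_le_sqn (x - y)
      nlinarith
    have hy' : y ∈ tsupport cutoff := by rwa [tsupport_cutoff, mem_closedBall_zero_iff]
    exact abs_cutoffRem_sub_le (by norm_num) hε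
      (((h1 y hy').trans (le_abs_self _)).trans hM1) (((h2 y hy').trans (le_abs_self _)).trans hM2)
      (((h3 y hy').trans (le_abs_self _)).trans hM3) (hfar x hx).2 (hfar x' hx').2 (hfar x hx).1
      (hfar x' hx').1 hd

lemma integrableOn_log_sqrt : IntegrableOn
    (fun p : ℝ × ℝ => Real.log (√(p.1 ^ 2 + p.2 ^ 2))) (Metric.closedBall 0 (1 / 2)) := by
  have hlog : IntegrableOn Real.log (Metric.closedBall (0:ℝ) (1 / 2)) := by
    rw [Real.closedBall_eq_Icc, integrableOn_Icc_iff_integrableOn_Ioc,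
      ← intervalIntegrable_iff_integrableOn_Ioc_of_le (by norm_num)]
    exact intervalIntegral.intervalIntegrable_log'
  have hball : Metric.closedBall (0 : ℝ × ℝ) (1 / 2)
      = Metric.closedBall (0:ℝ) (1 / 2) ×ˢ Metric.closedBall (0:ℝ) (1 / 2) :=
    (closedBall_prod_same (0:ℝ) (0:ℝ) (1 / 2)).symm
  have : IsFiniteMeasure (volume.restrict (Metric.closedBall (0:ℝ) (1 / 2))) :=
    ⟨by simp⟩
  have h1 : IntegrableOn (fun p : ℝ × ℝ => |Real.log p.1| + |Real.log p.2|)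
      (Metric.closedBall 0 (1 / 2)) := by
    rw [hball, IntegrableOn, Measure.volume_eq_prod, ← Measure.prod_restrict]
    exact (hlog.abs.comp_fst _).add (hlog.abs.comp_snd _)
  refine Integrable.mono' h1 ?_ ?_
  · exact (Real.measurable_log.comp (by fun_prop)).aestronglyMeasurable
  · filter_upwards [ae_restrict_mem Metric.isClosed_closedBall.measurableSet] with p hp
    rw [mem_closedBall_zero_iff] at hp
    have hN : sqn p ≤ 1 := (sqn_le_of_norm_le hp).trans (by norm_num)
    rw [Real.norm_eq_abs]
    rcases eq_or_ne p.1 0 with h0 | h0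
    · rw [h0]
      simp [Real.sqrt_sq_eq_abs]
    · have ha : |p.1| ≤ √(p.1 ^ 2 + p.2 ^ 2) := Real.abs_le_sqrt (by nlinarith [sq_nonneg p.2])
      have hb : √(p.1 ^ 2 + p.2 ^ 2) ≤ 1 := Real.sqrt_le_one.2 hN
      have hc := Real.log_le_log (abs_pos.2 h0) ha
      have hd := Real.log_nonpos (Real.sqrt_nonneg _) hb
      rw [Real.log_abs] at hc
      rw [abs_of_nonpos hd]
      have := neg_abs_le (Real.log p.1)
      have := abs_nonneg (Real.log p.2)
      linarith

lemma circ_mem {r : ℝ} (hr : 0 < r) (hr1 : r < 1) (θ : ℝ) : circ r θ ∈ disk 1 \ {(0, 0)} := by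
  refine ⟨?_, ?_⟩
  · change sqn (circ r θ) < 1 ^ 2
    rw [sqn_circ]
    gcongr
  · intro h
    have h1 := sqn_circ r θ
    rw [Set.mem_singleton_iff.1 h] at h1
    have : 0 < r ^ 2 := by positivity
    simp [sqn] at h1
    exact this.ne h1

lemma norm_circ_le {r : ℝ} (hr : 0 ≤ r) (θ : ℝ) : ‖circ r θ‖ ≤ r := by
  have h := norm_sq_le_sqn (circ r θ)
  rw [sqn_circ] at h
  exact le_of_sq_le_sq h hr

lemma norm_circ_sub_circ_le {r R : ℝ} (hrR : r ≤ R) (θ : ℝ) :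
    ‖circ R θ - circ r θ‖ ≤ R - r := by
  have : circ R θ - circ r θ = circ (R - r) θ := by
    simp only [circ, Prod.mk_sub_mk, sub_mul]
  rw [this]
  exact norm_circ_le (sub_nonneg.2 hrR) θ

lemma measurable_regLog (ε : ℝ) : Measurable (regLog ε) :=
  (Real.measurable_log.comp (continuous_sqn.measurable.add_const ε)).const_mul (1 / 2)

section Increments

variable {u ω F : ℝ × ℝ → ℝ} {m : ℕ}

lemma integrableOn_tsupport_cutoff (hω : ContinuousOn ω (disk 1))
    (hu : ∀ p ∈ disk 1 \ {(0, 0)}, u p = m * Real.log (√(p.1 ^ 2 + p.2 ^ 2)) + ω p) :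
    IntegrableOn u (tsupport cutoff) := by
  have h1 : IntegrableOn ω (tsupport cutoff) :=
    (hω.mono tsupport_cutoff_subset).integrableOn_compact cutoff.hasCompactSupport
  have h2 : IntegrableOn (fun p : ℝ × ℝ => m * Real.log (√(p.1 ^ 2 + p.2 ^ 2)))
      (tsupport cutoff) := by
    rw [tsupport_cutoff]
    exact integrableOn_log_sqrt.const_mul _
  refine (h2.add h1).congr ?_
  have h0 : ∀ᵐ p : ℝ × ℝ ∂volume.restrict (tsupport cutoff), p ≠ (0, 0) :=
    ae_restrict_of_ae (Measure.ae_ne volume _)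
  filter_upwards [h0, ae_restrict_mem (isClosed_tsupport cutoff).measurableSet] with p hp hp'
  exact (hu p ⟨tsupport_cutoff_subset hp', hp⟩).symm

lemma exists_increment_bound (hω : ContinuousOn ω (disk 1))
    (hu : ∀ p ∈ disk 1 \ {(0, 0)}, u p = m * Real.log (√(p.1 ^ 2 + p.2 ^ 2)) + ω p)
    (hF : IntegrableOn F (disk 1))
    (hdist : ∀ φ : ℝ × ℝ → ℝ, ContDiff ℝ (⊤ : ℕ∞) φ → HasCompactSupport φ → tsupport φ ⊆ disk 1 →
      -∫ p in disk 1, u p * lap φ p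
        = -(2 * π * m) * φ (0, 0) + ∫ p in disk 1, F p * φ p) :
    ∃ C : ℝ, 0 ≤ C ∧ ∀ r R : ℝ, 0 < r → r ≤ R → R ≤ 1 / 8 → ∀ θ : ℝ, ∃ J : ℝ → ℝ,
      Tendsto J (nhdsWithin 0 (Set.Ioi 0)) (nhds (2 * π * (ω (circ R θ) - ω (circ r θ)))) ∧
      ∀ ε : ℝ, 0 < ε → ‖J ε‖ₑ ≤
        (∫⁻ y in disk 1, ‖F y‖ₑ * ‖regLog ε (circ R θ - y) - regLog ε (circ r θ - y)‖ₑ)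
          + ENNReal.ofReal (C * (R - r)) := by
  have hχ : ContDiff ℝ (⊤ : ℕ∞) cutoff := cutoff.contDiff
  have hcs : HasCompactSupport cutoff := cutoff.hasCompactSupport
  have hmeas : MeasurableSet (tsupport cutoff) := (isClosed_tsupport cutoff).measurableSet
  have hui := integrableOn_tsupport_cutoff hω hu
  have hχ0 : cutoff (0, 0) = 1 := cutoff.eventuallyEq_one.eq_of_nhds
  obtain ⟨C, hC0, hC⟩ := exists_abs_cutoffRem_sub_le
  set I := ∫ y in tsupport cutoff, ‖u y‖ with hI
  have hI0 : 0 ≤ I := integral_nonneg fun y => norm_nonneg _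
  refine ⟨C * I, by positivity, ?_⟩
  intro r R hr hrR hR θ
  set A : ℝ → ℝ × ℝ → ℝ := fun ε x =>
    ∫ y, 2 * ε / (sqn (x - y) + ε) ^ 2 * ((tsupport cutoff).indicator u y * cutoff y) with hA
  have hlimA : ∀ ρ : ℝ, 0 < ρ → ρ ≤ 1 / 8 → Tendsto (fun ε => A ε (circ ρ θ)
      - 2 * π * m * regLog ε (circ ρ θ)) (nhdsWithin 0 (Set.Ioi 0))
      (nhds (2 * π * ω (circ ρ θ))) := by
    intro ρ hρ hρ8
    have hmem := circ_mem hρ (by linarith) θ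
    have hball : circ ρ θ ∈ Metric.ball (0 : ℝ × ℝ) (1 / 4) := by
      rw [mem_ball_zero_iff]
      linarith [norm_circ_le hρ.le θ]
    have hopen : IsOpen (disk 1 \ {((0:ℝ), (0:ℝ))}) := (isOpen_disk 1).sdiff isClosed_singleton
    have hev : (fun y => (tsupport cutoff).indicator u y * cutoff y) =ᶠ[nhds (circ ρ θ)]
        fun p => m * Real.log (√(p.1 ^ 2 + p.2 ^ 2)) + ω p := by
      filter_upwards [hopen.mem_nhds hmem, Metric.isOpen_ball.mem_nhds hball,
        cutoff.eventuallyEq_one_of_mem_ball (x := circ ρ θ) hball] with p hp hpb hp1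
      have hpt : p ∈ tsupport cutoff := by
        rw [tsupport_cutoff]
        rw [mem_ball_zero_iff] at hpb
        rw [mem_closedBall_zero_iff]
        linarith
      rw [Set.indicator_of_mem hpt, hp1, Pi.one_apply, mul_one, hu p hp]
    have hsq : (circ ρ θ).1 ^ 2 + (circ ρ θ).2 ^ 2 = ρ ^ 2 := sqn_circ ρ θ
    have hcont : ContinuousAt (fun y => (tsupport cutoff).indicator u y * cutoff y)
        (circ ρ θ) := by
      refine ContinuousAt.congr ?_ hev.symm
      refine ContinuousAt.add (continuousAt_const.mul (ContinuousAt.log ?_ ?_)) ?_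
      · exact Continuous.continuousAt (by fun_prop)
      · rw [hsq, Real.sqrt_sq hρ.le]
        exact hρ.ne'
      · exact hω.continuousAt ((isOpen_disk 1).mem_nhds hmem.1)
    have h1 := tendsto_integral_peak (integrable_mul_of_hasCompactSupport
      ((integrable_indicator_iff hmeas).2 hui) cutoff.continuous hcs) hcont
    have h2 : Tendsto (fun ε => 2 * π * m * regLog ε (circ ρ θ)) (nhdsWithin 0 (Set.Ioi 0))
        (nhds (2 * π * m * (1 / 2 * Real.log (sqn (circ ρ θ) + 0)))) := by
      refine Tendsto.mono_left ?_ nhdsWithin_le_nhds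
      unfold regLog
      refine ((Tendsto.log (tendsto_const_nhds.add tendsto_id) ?_).const_mul _).const_mul _
      rw [sqn_circ, add_zero]
      positivity
    convert h1.sub h2 using 2
    rw [hev.eq_of_nhds, hsq, sqn_circ, Real.sqrt_sq hρ.le, add_zero, Real.log_pow]
    push_cast
    ring
  have hr8 : r ≤ 1 / 8 := hrR.trans hR
  have hR0 : 0 < R := hr.trans_le hrR
  refine ⟨fun ε => (A ε (circ R θ) - 2 * π * m * regLog ε (circ R θ))
    - (A ε (circ r θ) - 2 * π * m * regLog ε (circ r θ)), ?_, ?_⟩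
  · rw [mul_sub]
    exact (hlimA R hR0 hR).sub (hlimA r hr hr8)
  intro ε hε
  have hFi (x : ℝ × ℝ) : IntegrableOn (fun y => F y * (cutoff y * regLog ε (x - y))) (disk 1) :=
    integrable_mul_of_hasCompactSupport hF
      (cutoff.continuous.mul (contDiff_regLog_sub (n := 0) hε x).continuous) hcs.mul_right
  have hRi (x : ℝ × ℝ) : IntegrableOn (fun y => u y * cutoffRem cutoff ε x y) (tsupport cutoff) :=
    integrable_mul_of_hasCompactSupport hui (continuous_cutoffRem hχ hε x)
      (hasCompactSupport_cutoffRem hcs ε x)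
  have hAeq (x : ℝ × ℝ) : A ε x = 2 * π * m * regLog ε x
      - (∫ y in disk 1, F y * (cutoff y * regLog ε (x - y)))
      - ∫ y in tsupport cutoff, u y * cutoffRem cutoff ε x y :=
    integral_peak_eq hχ hcs tsupport_cutoff_subset hχ0 hui hdist hε x
  have hJ : (A ε (circ R θ) - 2 * π * m * regLog ε (circ R θ))
      - (A ε (circ r θ) - 2 * π * m * regLog ε (circ r θ))
      = -(∫ y in disk 1, F y * (cutoff y * (regLog ε (circ R θ - y) - regLog ε (circ r θ - y))))
        - ∫ y in tsupport cutoff,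
          u y * (cutoffRem cutoff ε (circ R θ) y - cutoffRem cutoff ε (circ r θ) y) := by
    simp_rw [mul_sub]
    rw [integral_sub (hFi _) (hFi _), integral_sub (hRi _) (hRi _), hAeq, hAeq]
    ring
  simp only
  rw [hJ]
  refine (enorm_sub_le).trans (add_le_add ?_ ?_)
  · rw [enorm_neg]
    refine (enorm_integral_le_lintegral_enorm _).trans (lintegral_mono fun y => ?_)
    rw [enorm_mul, enorm_mul]
    have h1 : ‖cutoff y‖ₑ ≤ 1 := by
      rw [Real.enorm_eq_ofReal cutoff.nonneg]
      exact ENNReal.ofReal_le_one.2 cutoff.le_one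
    gcongr
    exact mul_le_of_le_one_left' h1
  · rw [← ofReal_norm]
    apply ENNReal.ofReal_le_ofReal
    refine (norm_integral_le_integral_norm _).trans ?_
    have : C * I * (R - r) = ∫ y in tsupport cutoff, ‖u y‖ * (C * (R - r)) := by
      rw [integral_mul_const, ← hI]
      ring
    rw [this]
    have hint := (hRi (circ R θ)).sub (hRi (circ r θ))
    refine setIntegral_mono_on (hint.norm.congr (Eventually.of_forall fun y => ?_))
      (hui.norm.mul_const _) hmeas fun y hy => ?_
    · simp [mul_sub]
    · rw [norm_mul]
      gcongr
      exact hC ε hε _ _ ((norm_circ_le hR0.le θ).trans hR) ((norm_circ_le hr.le θ).trans hr8) _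
        (norm_circ_sub_circ_le hrR θ) y hy

/-- The bound for `∫ |regLog ε (t e^{h+iθ} - y) - regLog ε (t e^{-h+iθ} - y)| dθ / h`. -/
def angularBound (t : ℝ) (y : ℝ × ℝ) : ℝ := if sqn y < t then 4 * π else 48 * π * √t

lemma exp_sub_exp_neg_le {h : ℝ} (hh : 0 < h) (hh1 : h ≤ 1) :
    exp h - exp (-h) ≤ 4 * h := by
  have h1 := (le_abs_self _).trans (Real.abs_exp_sub_one_le (x := h) (by rwa [abs_of_pos hh]))
  have h2 := (neg_le_abs _).trans
    (Real.abs_exp_sub_one_le (x := -h) (by rwa [abs_neg, abs_of_pos hh]))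
  rw [abs_of_pos hh] at h1
  rw [abs_neg, abs_of_pos hh] at h2
  linarith

lemma exp_le_three {h : ℝ} (hh1 : h ≤ 1) : exp h ≤ 3 :=
  (Real.exp_le_exp.2 hh1).trans (by linarith [Real.exp_one_lt_d9])

lemma lintegral_regLog_sub_le {ε t h : ℝ} (hε : 0 < ε) (ht : 0 < t) (ht1 : t ≤ 1 / 100)
    (hh : 0 < h) (hh1 : h ≤ 1) (y : ℝ × ℝ) :
    ∫⁻ θ in Set.Ioc 0 (2 * π),
      ‖regLog ε (circ (t * exp h) θ - y) - regLog ε (circ (t * exp (-h)) θ - y)‖ₑ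
      ≤ ENNReal.ofReal h * ENNReal.ofReal (angularBound t y) := by
  have hpi := Real.pi_pos
  have hq : Continuous fun θ =>
      regLog ε (circ (t * exp h) θ - y) - regLog ε (circ (t * exp (-h)) θ - y) :=
    ((continuous_regLog hε).comp ((continuous_circ_right _).sub continuous_const)).sub
      ((continuous_regLog hε).comp ((continuous_circ_right _).sub continuous_const))
  have hle : t * exp (-h) ≤ t * exp h := by
    gcongr
    linarith
  simp_rw [← ofReal_norm]
  rw [← ofReal_integral_eq_lintegral_ofReal
    ((hq.norm.intervalIntegrable 0 (2 * π)).1) (Eventually.of_forall fun θ => norm_nonneg _),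
    ← intervalIntegral.integral_of_le (by positivity), ← ENNReal.ofReal_mul hh.le]
  apply ENNReal.ofReal_le_ofReal
  simp_rw [Real.norm_eq_abs]
  unfold angularBound
  split_ifs with hy
  · linarith [integral_abs_regLog_sub_le hε ht hh y]
  · rw [not_lt] at hy
    have hR : t * exp h ≤ 3 * t := by nlinarith [exp_le_three hh1]
    have hR2 : 4 * (t * exp h) ^ 2 ≤ sqn y := by
      have : (t * exp h) ^ 2 ≤ (3 * t) ^ 2 := by gcongr
      nlinarith
    have hpt : ∀ θ, |regLog ε (circ (t * exp h) θ - y) - regLog ε (circ (t * exp (-h)) θ - y)|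
        ≤ 24 * h * √t := by
      intro θ
      refine (abs_regLog_circ_sub_le hε (by positivity) hle (ht.trans_le hy) hR2).trans ?_
      have h1 : √t ≤ √(sqn y) := Real.sqrt_le_sqrt hy
      have h2 : 0 < √t := Real.sqrt_pos.2 ht
      have h3 : t * exp h - t * exp (-h) ≤ t * (4 * h) := by
        rw [← mul_sub]
        gcongr
        exact exp_sub_exp_neg_le hh hh1
      calc _ ≤ 6 * (t * (4 * h)) / √t := by gcongr
        _ = 24 * h * √t := by
          rw [div_eq_iff h2.ne', mul_assoc, Real.mul_self_sqrt ht.le]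
          ring
    calc _ ≤ ∫ θ in (0:ℝ)..2 * π, 24 * h * √t :=
          intervalIntegral.integral_mono_on (by positivity) (hq.abs.intervalIntegrable _ _)
            intervalIntegrable_const fun θ _ => hpt θ
      _ = h * (48 * π * √t) := by
          simp
          ring

lemma lintegral_increment_le {ν : Measure (ℝ × ℝ)} [IsFiniteMeasure ν] {C t h : ℝ}
    (hC0 : 0 ≤ C) (ht : 0 < t) (ht1 : t ≤ 1 / 100) (hh : 0 < h) (hh1 : h ≤ 1)
    (hC : ∀ θ : ℝ, ∃ J : ℝ → ℝ, Tendsto J (nhdsWithin 0 (Set.Ioi 0))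
        (nhds (2 * π * (ω (circ (t * exp h) θ) - ω (circ (t * exp (-h)) θ)))) ∧
      ∀ ε : ℝ, 0 < ε → ‖J ε‖ₑ ≤
        (∫⁻ y, ‖regLog ε (circ (t * exp h) θ - y) - regLog ε (circ (t * exp (-h)) θ - y)‖ₑ ∂ν)
          + ENNReal.ofReal (C * (t * exp h - t * exp (-h)))) :
    ∫⁻ θ in Set.Ioc 0 (2 * π), ‖ω (circ (t * exp h) θ) - ω (circ (t * exp (-h)) θ)‖ₑ
      ≤ ENNReal.ofReal h * ((∫⁻ y, ENNReal.ofReal (angularBound t y) ∂ν)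
        + ENNReal.ofReal (8 * π * C * t)) := by
  have hpi := Real.pi_gt_three
  set q : ℝ → ℝ → ℝ × ℝ → ENNReal := fun ε θ y =>
    ‖regLog ε (circ (t * exp h) θ - y) - regLog ε (circ (t * exp (-h)) θ - y)‖ₑ with hq
  have hqm (ε : ℝ) : Measurable (Function.uncurry (q ε)) := by
    have h1 (r : ℝ) : Measurable fun p : ℝ × (ℝ × ℝ) => regLog ε (circ r p.1 - p.2) :=
      (measurable_regLog ε).comp
        (((continuous_circ_right r).comp continuous_fst).sub continuous_snd).measurable
    exact ((h1 _).sub (h1 _)).enorm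
  set c := ENNReal.ofReal (C * (t * exp h - t * exp (-h))) with hc
  have hpt : ∀ θ, ‖ω (circ (t * exp h) θ) - ω (circ (t * exp (-h)) θ)‖ₑ
      ≤ liminf (fun ε => (∫⁻ y, q ε θ y ∂ν) + c) (nhdsWithin 0 (Set.Ioi 0)) := by
    intro θ
    obtain ⟨J, hJ, hJb⟩ := hC θ
    calc _ ≤ ‖2 * π * (ω (circ (t * exp h) θ) - ω (circ (t * exp (-h)) θ))‖ₑ := by
          rw [enorm_mul]
          refine le_mul_of_one_le_left' ?_
          rw [Real.enorm_eq_ofReal (by positivity)]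
          exact ENNReal.one_le_ofReal.2 (by linarith)
      _ = liminf (fun ε => ‖J ε‖ₑ) (nhdsWithin 0 (Set.Ioi 0)) := hJ.enorm.liminf_eq.symm
      _ ≤ _ := by
          refine liminf_le_liminf ?_
          filter_upwards [self_mem_nhdsWithin] with ε hε using hJb ε hε
  refine (lintegral_mono hpt).trans ((lintegral_liminf_le fun ε =>
    ((hqm ε).lintegral_prod_right').add_const c).trans ?_)
  have hbound : ∀ᶠ ε in nhdsWithin (0:ℝ) (Set.Ioi 0),
      ∫⁻ θ in Set.Ioc 0 (2 * π), ((∫⁻ y, q ε θ y ∂ν) + c)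
      ≤ ENNReal.ofReal h * ((∫⁻ y, ENNReal.ofReal (angularBound t y) ∂ν)
        + ENNReal.ofReal (8 * π * C * t)) := by
    filter_upwards [self_mem_nhdsWithin] with ε hε
    rw [lintegral_add_right _ measurable_const, lintegral_lintegral_swap (hqm ε).aemeasurable,
      mul_add]
    refine add_le_add ?_ ?_
    · rw [← lintegral_const_mul']
      · exact lintegral_mono fun y => lintegral_regLog_sub_le hε ht ht1 hh hh1 y
      · exact ENNReal.ofReal_ne_top
    · rw [lintegral_const, Measure.restrict_apply_univ, Real.volume_Ioc, sub_zero, hc,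
        ← ENNReal.ofReal_mul', ← ENNReal.ofReal_mul hh.le]
      · apply ENNReal.ofReal_le_ofReal
        have h3 := exp_sub_exp_neg_le hh hh1
        calc C * (t * exp h - t * exp (-h)) * (2 * π)
            = C * t * (2 * π) * (exp h - exp (-h)) := by ring
          _ ≤ C * t * (2 * π) * (4 * h) := by gcongr
          _ = h * (8 * π * C * t) := by ring
      · positivity
  exact (liminf_le_liminf hbound).trans_eq (liminf_const _)

end Increments

/-- The radial derivative `x ↦ x · ∇f(x)` along the circle of radius `t`. -/
def radialDeriv (f : ℝ × ℝ → ℝ) (t θ : ℝ) : ℝ := fderiv ℝ f (circ t θ) (circ t θ)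

lemma hasDerivAt_circ_exp (t θ : ℝ) :
    HasDerivAt (fun s : ℝ => circ (t * exp s) θ) (circ t θ) 0 := by
  have h : HasDerivAt (fun s : ℝ => t * exp s) t 0 := by
    simpa using (Real.hasDerivAt_exp 0).const_mul t
  exact (h.mul_const (Real.cos θ)).prodMk (h.mul_const (Real.sin θ))

lemma hasDerivAt_comp_circ_exp {f : ℝ × ℝ → ℝ} {t θ : ℝ}
    (hf : DifferentiableAt ℝ f (circ t θ)) :
    HasDerivAt (fun s : ℝ => f (circ (t * exp s) θ)) (radialDeriv f t θ) 0 := by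
  have h : HasFDerivAt f (fderiv ℝ f (circ t θ)) (circ (t * exp 0) θ) := by
    simpa using hf.hasFDerivAt
  exact h.comp_hasDerivAt 0 (hasDerivAt_circ_exp t θ)

lemma tendsto_symmetric_slope {f : ℝ → ℝ} {f' : ℝ} (hf : HasDerivAt f f' 0) :
    Tendsto (fun n : ℕ => ((n : ℝ) + 1) * (f (1 / ((n : ℝ) + 1)) - f (-(1 / ((n : ℝ) + 1)))))
      atTop (nhds (2 * f')) := by
  have h1 : HasDerivAt (fun s : ℝ => f s - f (-s)) (2 * f') 0 := by
    have h2 : HasDerivAt (fun s : ℝ => f (-s)) (-f') 0 := by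
      have h3 : HasDerivAt f f' (-0) := by simpa using hf
      have h4 := h3.comp 0 (hasDerivAt_neg 0)
      rwa [mul_neg_one] at h4
    rw [two_mul, ← sub_neg_eq_add]
    exact hf.sub h2
  have h2 : Tendsto (fun n : ℕ => 1 / ((n : ℝ) + 1)) atTop (nhdsWithin 0 (Set.Ioi 0)) :=
    tendsto_nhdsWithin_iff.2 ⟨tendsto_one_div_add_atTop_nhds_zero_nat,
      Eventually.of_forall fun n => Set.mem_Ioi.2 Nat.one_div_pos_of_nat⟩
  refine (h1.tendsto_slope_zero_right.comp h2).congr fun n => ?_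
  simp

section Flux

variable {u ω F : ℝ × ℝ → ℝ} {m : ℕ}

lemma mul_exp_le {t h : ℝ} (ht : 0 < t) (ht1 : t ≤ 1 / 100) (hh1 : h ≤ 1) :
    t * exp h ≤ 1 / 8 := by
  nlinarith [exp_le_three hh1]

lemma lintegral_radialDeriv_le (hω : ContinuousOn ω (disk 1))
    (hωd : DifferentiableOn ℝ ω (disk 1)) {t : ℝ} (ht : 0 < t) (ht1 : t ≤ 1 / 100)
    {E : ENNReal} (hE : ∀ h : ℝ, 0 < h → h ≤ 1 →
      ∫⁻ θ in Set.Ioc 0 (2 * π), ‖ω (circ (t * exp h) θ) - ω (circ (t * exp (-h)) θ)‖ₑ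
        ≤ ENNReal.ofReal h * E) :
    Measurable (radialDeriv ω t) ∧ ∫⁻ θ in Set.Ioc 0 (2 * π), ‖radialDeriv ω t θ‖ₑ ≤ E := by
  set D : ℕ → ℝ → ℝ := fun n θ => ((n : ℝ) + 1) *
    (ω (circ (t * exp (1 / ((n : ℝ) + 1))) θ) - ω (circ (t * exp (-(1 / ((n : ℝ) + 1)))) θ))
    with hD
  have hn0 (n : ℕ) : (0 : ℝ) < 1 / ((n : ℝ) + 1) := Nat.one_div_pos_of_nat
  have hn1 (n : ℕ) : 1 / ((n : ℝ) + 1) ≤ 1 := by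
    rw [div_le_one (by positivity)]
    linarith [n.cast_nonneg (α := ℝ)]
  have hcont (s : ℝ) (hs : s ≤ 1) : Continuous fun θ => ω (circ (t * exp s) θ) :=
    hω.comp_continuous (continuous_circ_right _) fun θ =>
      (circ_mem (by positivity) (by linarith [mul_exp_le ht ht1 hs]) θ).1
  have hDm (n : ℕ) : Measurable (D n) :=
    (continuous_const.mul ((hcont _ (hn1 n)).sub
      (hcont _ (by linarith [hn0 n])))).measurable
  have hlim (θ : ℝ) : Tendsto (fun n => D n θ) atTop (nhds (2 * radialDeriv ω t θ)) := by
    have hd : DifferentiableAt ℝ ω (circ t θ) :=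
      hωd.differentiableAt ((isOpen_disk 1).mem_nhds (circ_mem ht (by linarith) θ).1)
    exact tendsto_symmetric_slope (hasDerivAt_comp_circ_exp hd)
  have hm2 : Measurable fun θ => 2 * radialDeriv ω t θ :=
    measurable_of_tendsto_metrizable hDm (tendsto_pi_nhds.2 hlim)
  refine ⟨by simpa using hm2.const_mul (1 / 2), ?_⟩
  have hDE (n : ℕ) : ∫⁻ θ in Set.Ioc 0 (2 * π), ‖D n θ‖ₑ ≤ E := by
    simp only [hD, enorm_mul]
    rw [lintegral_const_mul' _ _ enorm_ne_top]
    calc _ ≤ ‖(n : ℝ) + 1‖ₑ * (ENNReal.ofReal (1 / ((n : ℝ) + 1)) * E) := by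
          gcongr
          exact hE _ (hn0 n) (hn1 n)
      _ = E := by
          rw [← mul_assoc, Real.enorm_eq_ofReal (by positivity),
            ← ENNReal.ofReal_mul (by positivity), mul_one_div_cancel (by positivity),
            ENNReal.ofReal_one, one_mul]
  calc ∫⁻ θ in Set.Ioc 0 (2 * π), ‖radialDeriv ω t θ‖ₑ
      ≤ ∫⁻ θ in Set.Ioc 0 (2 * π), liminf (fun n => ‖D n θ‖ₑ) atTop := by
        refine lintegral_mono fun θ => ?_
        rw [(hlim θ).enorm.liminf_eq, enorm_mul]
        refine le_mul_of_one_le_left' ?_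
        rw [Real.enorm_eq_ofReal (by positivity)]
        exact ENNReal.one_le_ofReal.2 (by norm_num)
    _ ≤ liminf (fun n => ∫⁻ θ in Set.Ioc 0 (2 * π), ‖D n θ‖ₑ) atTop :=
        lintegral_liminf_le fun n => (hDm n).enorm
    _ ≤ liminf (fun _ : ℕ => E) atTop := liminf_le_liminf (Eventually.of_forall hDE)
    _ = E := liminf_const E

lemma flux_integrand_eq (hωd : DifferentiableOn ℝ ω (disk 1))
    (hu : ∀ p ∈ disk 1 \ {(0, 0)}, u p = m * Real.log (√(p.1 ^ 2 + p.2 ^ 2)) + ω p)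
    (hud : DifferentiableOn ℝ u (disk 1 \ {(0, 0)})) {t : ℝ} (ht : 0 < t) (ht1 : t < 1) (θ : ℝ) :
    fderiv ℝ u (t * Real.cos θ, t * Real.sin θ) (Real.cos θ, Real.sin θ) * t
      = m + radialDeriv ω t θ := by
  have hmem := circ_mem ht ht1 θ
  have hopen : IsOpen (disk 1 \ {((0:ℝ), (0:ℝ))}) := (isOpen_disk 1).sdiff isClosed_singleton
  have h1 := hasDerivAt_comp_circ_exp (hud.differentiableAt (hopen.mem_nhds hmem))
  have h2 := hasDerivAt_comp_circ_exp (hωd.differentiableAt ((isOpen_disk 1).mem_nhds hmem.1))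
  have h3 : HasDerivAt (fun s : ℝ => m * (Real.log t + s) + ω (circ (t * exp s) θ))
      (m + radialDeriv ω t θ) 0 := by
    have h4 := (((hasDerivAt_id (0 : ℝ)).const_add (Real.log t)).const_mul (m : ℝ)).add h2
    rwa [mul_one] at h4
  have hev : (fun s : ℝ => u (circ (t * exp s) θ)) =ᶠ[nhds 0]
      fun s => m * (Real.log t + s) + ω (circ (t * exp s) θ) := by
    have hc : ContinuousAt (fun s : ℝ => circ (t * exp s) θ) 0 :=
      (hasDerivAt_circ_exp t θ).continuousAt
    have h0 : circ (t * exp 0) θ ∈ disk 1 \ {(0, 0)} := by simpa using hmem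
    filter_upwards [hc.preimage_mem_nhds (hopen.mem_nhds h0)] with s hs
    rw [hu _ hs]
    have h4 : (circ (t * exp s) θ).1 ^ 2 + (circ (t * exp s) θ).2 ^ 2 = (t * exp s) ^ 2 :=
      sqn_circ _ _
    rw [h4, Real.sqrt_sq (by positivity), Real.log_mul ht.ne' (exp_pos s).ne', Real.log_exp]
  have h5 := h1.unique (h3.congr_of_eventuallyEq hev)
  rw [← h5, radialDeriv]
  have : circ t θ = t • (Real.cos θ, Real.sin θ) := by simp [circ]
  rw [mul_comm, ← smul_eq_mul, ← map_smul, ← this]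
  rfl

lemma tendsto_lintegral_angularBound {ν : Measure (ℝ × ℝ)} [IsFiniteMeasure ν]
    (hν : ν ≪ volume) :
    Tendsto (fun t => ∫⁻ y, ENNReal.ofReal (angularBound t y) ∂ν) (nhdsWithin 0 (Set.Ioi 0))
      (nhds 0) := by
  have h := tendsto_lintegral_filter_of_dominated_convergence (μ := ν)
    (l := nhdsWithin (0 : ℝ) (Set.Ioi 0))
    (F := fun t y => ENNReal.ofReal (angularBound t y)) (f := fun _ => 0)
    (fun _ => ENNReal.ofReal (48 * π)) ?_ ?_ ?_ ?_
  · simpa using h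
  · refine Eventually.of_forall fun t => Measurable.ennreal_ofReal ?_
    exact Measurable.ite (continuous_sqn.measurable measurableSet_Iio) measurable_const
      measurable_const
  · have h1 : ∀ᶠ t : ℝ in nhdsWithin 0 (Set.Ioi 0), t ≤ 1 :=
      nhdsWithin_le_nhds (Iic_mem_nhds one_pos)
    filter_upwards [h1] with t ht
    refine Eventually.of_forall fun y => ENNReal.ofReal_le_ofReal ?_
    have hpi := Real.pi_pos
    have := Real.sqrt_le_one.2 ht
    unfold angularBound
    split_ifs
    · linarith
    · exact mul_le_of_le_one_right (by positivity) this
  · simp [ENNReal.mul_eq_top]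
  · have h0 : ∀ᵐ y : ℝ × ℝ ∂ν, y ≠ 0 := hν.ae_le (Measure.ae_ne volume _)
    filter_upwards [h0] with y hy
    have hpos : 0 < sqn y := by
      have h2 := norm_sq_le_sqn y
      have h3 : 0 < ‖y‖ := norm_pos_iff.2 hy
      nlinarith
    have h1 : Tendsto (fun t : ℝ => ENNReal.ofReal (48 * π * √t)) (nhdsWithin 0 (Set.Ioi 0))
        (nhds (ENNReal.ofReal (48 * π * √0))) := by
      refine Tendsto.mono_left ?_ nhdsWithin_le_nhds
      exact (ENNReal.continuous_ofReal.comp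
        (continuous_const.mul Real.continuous_sqrt)).tendsto 0
    rw [Real.sqrt_zero, mul_zero, ENNReal.ofReal_zero] at h1
    refine h1.congr' ?_
    filter_upwards [nhdsWithin_le_nhds (Iic_mem_nhds hpos)] with t ht
    rw [angularBound, if_neg (not_lt.2 ht)]

lemma lintegral_angularBound_lt_top {ν : Measure (ℝ × ℝ)} [IsFiniteMeasure ν] (t : ℝ) :
    ∫⁻ y, ENNReal.ofReal (angularBound t y) ∂ν < ⊤ := by
  have h : ∀ y, ENNReal.ofReal (angularBound t y) ≤ ENNReal.ofReal (max (4 * π) (48 * π * √t)) := by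
    intro y
    apply ENNReal.ofReal_le_ofReal
    unfold angularBound
    split_ifs
    · exact le_max_left _ _
    · exact le_max_right _ _
  refine (lintegral_mono h).trans_lt ?_
  rw [lintegral_const]
  exact ENNReal.mul_lt_top ENNReal.ofReal_lt_top (measure_lt_top _ _)

end Flux

/-- if `u(z) = m log|z| + ω(z)` with `ω ∈ C⁰ ∩ W^{1,2}(D)` and
`-Δu = -2mπ δ₀ + F` distributionally on `D` with `F ∈ L¹(D)`, then
`lim_{t→0⁺} ∫_{∂D_t} ∂u/∂r ds = 2πm`. -/
theorem stmt0 (u ω F : ℝ × ℝ → ℝ) (m : ℕ)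
    (hω_cont : ContinuousOn ω (disk 1))
    (hω_diff : DifferentiableOn ℝ ω (disk 1))
    (hω_W12 : IntegrableOn (fun p => ‖fderiv ℝ ω p‖ ^ 2) (disk 1))
    (hu_dec : ∀ p ∈ disk 1 \ {(0, 0)},
      u p = m * Real.log (Real.sqrt (p.1 ^ 2 + p.2 ^ 2)) + ω p)
    (hu_diff : DifferentiableOn ℝ u (disk 1 \ {(0, 0)}))
    (hF : IntegrableOn F (disk 1))
    (hdist : ∀ φ : ℝ × ℝ → ℝ, ContDiff ℝ (⊤ : ℕ∞) φ → HasCompactSupport φ →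
      tsupport φ ⊆ disk 1 →
      -∫ p in disk 1, u p * lap φ p
        = -(2 * π * m) * φ (0, 0) + ∫ p in disk 1, F p * φ p) :
    Tendsto (flux u) (nhdsWithin 0 (Set.Ioi 0)) (nhds (2 * π * m)) := by
  set ν : Measure (ℝ × ℝ) := (volume.restrict (disk 1)).withDensity fun y => ‖F y‖ₑ with hν
  have : IsFiniteMeasure ν := isFiniteMeasure_withDensity hF.2.ne
  have hνac : ν ≪ volume :=
    (withDensity_absolutelyContinuous _ _).trans Measure.absolutelyContinuous_restrict
  obtain ⟨C, hC0, hC⟩ := exists_increment_bound hω_cont hu_dec hF hdist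
  set E : ℝ → ENNReal := fun t => (∫⁻ y, ENNReal.ofReal (angularBound t y) ∂ν)
    + ENNReal.ofReal (8 * π * C * t) with hE
  have hEtop (t : ℝ) : E t < ⊤ :=
    ENNReal.add_lt_top.2 ⟨lintegral_angularBound_lt_top t, ENNReal.ofReal_lt_top⟩
  have hE0 : Tendsto E (nhdsWithin 0 (Set.Ioi 0)) (nhds 0) := by
    have h1 : Tendsto (fun t : ℝ => ENNReal.ofReal (8 * π * C * t)) (nhdsWithin 0 (Set.Ioi 0))
        (nhds (ENNReal.ofReal (8 * π * C * 0))) :=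
      ((ENNReal.continuous_ofReal.comp (continuous_const_mul _)).tendsto 0).mono_left
        nhdsWithin_le_nhds
    simpa using (tendsto_lintegral_angularBound hνac).add h1
  have hinc (t : ℝ) (ht : 0 < t) (ht1 : t ≤ 1 / 100) (h : ℝ) (hh : 0 < h) (hh1 : h ≤ 1) :
      ∫⁻ θ in Set.Ioc 0 (2 * π), ‖ω (circ (t * exp h) θ) - ω (circ (t * exp (-h)) θ)‖ₑ
        ≤ ENNReal.ofReal h * E t := by
    refine lintegral_increment_le hC0 ht ht1 hh hh1 fun θ => ?_
    have hle : t * exp (-h) ≤ t * exp h := by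
      gcongr
      linarith
    obtain ⟨J, hJ, hJb⟩ := hC (t * exp (-h)) (t * exp h) (by positivity) hle
      (mul_exp_le ht ht1 hh1) θ
    refine ⟨J, hJ, fun ε hε => (hJb ε hε).trans_eq ?_⟩
    have hm (r : ℝ) : Measurable fun y => regLog ε (circ r θ - y) :=
      (measurable_regLog ε).comp (measurable_const.sub measurable_id)
    congr 1
    exact (lintegral_withDensity_eq_lintegral_mul₀ hF.1.enorm
      ((hm _).sub (hm _)).enorm.aemeasurable).symm
  have hclose : ∀ᶠ t in nhdsWithin (0 : ℝ) (Set.Ioi 0), ‖flux u t - 2 * π * m‖ₑ ≤ E t := by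
    have h1 : ∀ᶠ t : ℝ in nhdsWithin 0 (Set.Ioi 0), t ≤ 1 / 100 :=
      nhdsWithin_le_nhds (Iic_mem_nhds (by norm_num))
    filter_upwards [h1, self_mem_nhdsWithin] with t ht1 ht
    obtain ⟨hmeas, hle⟩ := lintegral_radialDeriv_le hω_cont hω_diff ht ht1 (hinc t ht ht1)
    have hint : IntegrableOn (radialDeriv ω t) (Set.Ioc 0 (2 * π)) :=
      ⟨hmeas.aestronglyMeasurable, hle.trans_lt (hEtop t)⟩
    have hpi : (0 : ℝ) ≤ 2 * π := by positivity
    have hflux : flux u t - 2 * π * m = ∫ θ in Set.Ioc 0 (2 * π), radialDeriv ω t θ := by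
      have h2 (θ : ℝ) := flux_integrand_eq hω_diff hu_dec hu_diff ht (by linarith) θ
      simp only [flux, h2]
      rw [intervalIntegral.integral_add intervalIntegrable_const
        ((intervalIntegrable_iff_integrableOn_Ioc_of_le hpi).2 hint),
        intervalIntegral.integral_of_le (f := radialDeriv ω t) hpi]
      simp
    rw [hflux]
    exact (enorm_integral_le_lintegral_enorm _).trans hle
  rw [tendsto_iff_edist_tendsto_0]
  refine tendsto_of_tendsto_of_tendsto_of_le_of_le' tendsto_const_nhds hE0
    (Eventually.of_forall fun _ => zero_le) ?_
  simpa only [edist_eq_enorm_sub] using hclose
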